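/- For every nonnegative integer n, G_0(n) - G_1(n) = H(n), where G_0(n) (resp. G_1(n)) counts the partitions counted by G(n) with an even (resp. odd) number of blue even parts, and H(n) is the number of partitions of n in which the odd parts are distinct. -/

import Mathlib

noncomputable section

/-- Overpartitions of `n`: the first component is the set of overlined parts
(at most one overlined part of each size), the second is the multiset of
non-overlined parts; all parts are positive and the total sum is `n`. -/
def overpartitions (n : ℕ) : Set (Finset ℕ × Multiset ℕ) :=
  {p | (∀ x ∈ p.1, 0 < x) ∧ (∀ x ∈ p.2, 0 < x) ∧ p.1.sum id + p.2.sum = n}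

/-- `p̄(n)`, the number of overpartitions of `n`. -/
def pbar (n : ℕ) : ℕ := (overpartitions n).ncard

/-- Overpartitions of `n` into odd parts. -/
def overpartitionsOdd (n : ℕ) : Set (Finset ℕ × Multiset ℕ) :=
  {p | p ∈ overpartitions n ∧ (∀ x ∈ p.1, Odd x) ∧ ∀ x ∈ p.2, Odd x}

/-- `p̄_o(n)`, the number of overpartitions of `n` into odd parts. -/
def pbarOdd (n : ℕ) : ℕ := (overpartitionsOdd n).ncard

/-- Two-color partitions of `n` (first component: blue parts, second: green
parts) in which even parts may occur only in the blue color, i.e. all green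
parts are odd. -/
def FSet (n : ℕ) : Set (Multiset ℕ × Multiset ℕ) :=
  {p | (∀ x ∈ p.1, 0 < x) ∧ (∀ x ∈ p.2, 0 < x) ∧ p.1.sum + p.2.sum = n ∧
    ∀ x ∈ p.2, Odd x}

/-- `F(n)`. -/
def Fcount (n : ℕ) : ℕ := (FSet n).ncard

/-- The number of even parts of a multiset of naturals. -/
def evenParts (m : Multiset ℕ) : ℕ := Multiset.card (m.filter (fun x => Even x))

/-- `F₀(n)`: partitions counted by `F(n)` with an even number of even parts. -/
def F0 (n : ℕ) : ℕ := {p ∈ FSet n | Even (evenParts (p.1 + p.2))}.ncard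

/-- `F₁(n)`: partitions counted by `F(n)` with an odd number of even parts. -/
def F1 (n : ℕ) : ℕ := {p ∈ FSet n | Odd (evenParts (p.1 + p.2))}.ncard

/-- `F₂(n)`: partitions counted by `F(n)` with an even number of parts. -/
def F2 (n : ℕ) : ℕ := {p ∈ FSet n | Even (Multiset.card (p.1 + p.2))}.ncard

/-- `F₃(n)`: partitions counted by `F(n)` with an odd number of parts. -/
def F3 (n : ℕ) : ℕ := {p ∈ FSet n | Odd (Multiset.card (p.1 + p.2))}.ncard

/-- Partitions counted by `F(n)` whose blue parts are distinct odd numbers. -/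
def QSet (n : ℕ) : Set (Multiset ℕ × Multiset ℕ) :=
  {p | p ∈ FSet n ∧ (∀ x ∈ p.1, Odd x) ∧ p.1.Nodup}

/-- `Q(n)`. -/
def Qcount (n : ℕ) : ℕ := (QSet n).ncard

/-- Two-color partitions of `n` (first component: blue parts, second: green
parts) in which odd parts may occur only in the blue color, i.e. all green
parts are even. -/
def GSet (n : ℕ) : Set (Multiset ℕ × Multiset ℕ) :=
  {p | (∀ x ∈ p.1, 0 < x) ∧ (∀ x ∈ p.2, 0 < x) ∧ p.1.sum + p.2.sum = n ∧
    ∀ x ∈ p.2, Even x}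

/-- `G(n)`. -/
def Gcount (n : ℕ) : ℕ := (GSet n).ncard

/-- `G₀(n)`: partitions counted by `G(n)` with an even number of blue even parts. -/
def G0 (n : ℕ) : ℕ := {p ∈ GSet n | Even (evenParts p.1)}.ncard

/-- `G₁(n)`: partitions counted by `G(n)` with an odd number of blue even parts. -/
def G1 (n : ℕ) : ℕ := {p ∈ GSet n | Odd (evenParts p.1)}.ncard

/-- `G₂(n)`: partitions counted by `G(n)` with an even number of blue parts. -/
def G2 (n : ℕ) : ℕ := {p ∈ GSet n | Even (Multiset.card p.1)}.ncard

/-- `G₃(n)`: partitions counted by `G(n)` with an odd number of blue parts. -/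
def G3 (n : ℕ) : ℕ := {p ∈ GSet n | Odd (Multiset.card p.1)}.ncard

/-- `G₄(n)`: partitions counted by `G(n)` with an even total number of parts. -/
def G4 (n : ℕ) : ℕ := {p ∈ GSet n | Even (Multiset.card (p.1 + p.2))}.ncard

/-- `G₅(n)`: partitions counted by `G(n)` with an odd total number of parts. -/
def G5 (n : ℕ) : ℕ := {p ∈ GSet n | Odd (Multiset.card (p.1 + p.2))}.ncard

/-- Partitions of `n` in which the odd parts are distinct. -/
def HSet (n : ℕ) : Set (Multiset ℕ) :=
  {m | (∀ x ∈ m, 0 < x) ∧ m.sum = n ∧ (m.filter (fun x => Odd x)).Nodup}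

/-- `H(n)`. -/
def Hcount (n : ℕ) : ℕ := (HSet n).ncard

/-- Partitions of `n` into distinct parts whose even parts are all
congruent to `2` modulo `4`. -/
def KSet (n : ℕ) : Set (Finset ℕ) :=
  {s | (∀ x ∈ s, 0 < x) ∧ s.sum id = n ∧ ∀ x ∈ s, Even x → x % 4 = 2}

/-- `K(n)`: the signed count of partitions in `KSet n`, each weighted by
`(-1)^j` where `j` is the number of even parts. -/
def Kcount (n : ℕ) : ℤ :=
  ({s ∈ KSet n | Even (s.filter (fun x => Even x)).card}.ncard : ℤ) -
  ({s ∈ KSet n | Odd (s.filter (fun x => Even x)).card}.ncard : ℤ)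

/-- Partitions counted by `G(n)` whose blue parts are distinct odd numbers. -/
def RSet (n : ℕ) : Set (Multiset ℕ × Multiset ℕ) :=
  {p | p ∈ GSet n ∧ (∀ x ∈ p.1, Odd x) ∧ p.1.Nodup}

/-- `R(n)`. -/
def Rcount (n : ℕ) : ℕ := (RSet n).ncard

/-- Two-color partitions of `n` in which all parts of the same color are
distinct and odd parts may occur only in the blue color: the first component
is the (finite) set of blue parts (distinct positive integers), the second the
set of green parts (distinct positive even integers). -/
def LSet (n : ℕ) : Set (Finset ℕ × Finset ℕ) :=
  {p | (∀ x ∈ p.1, 0 < x) ∧ (∀ x ∈ p.2, 0 < x ∧ Even x) ∧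
    p.1.sum id + p.2.sum id = n}

/-- `L₀(n)`: partitions counted by `L(n)` with an even number of blue even parts. -/
def L0 (n : ℕ) : ℕ := {p ∈ LSet n | Even (p.1.filter (fun x => Even x)).card}.ncard

/-- `L₁(n)`: partitions counted by `L(n)` with an odd number of blue even parts. -/
def L1 (n : ℕ) : ℕ := {p ∈ LSet n | Odd (p.1.filter (fun x => Even x)).card}.ncard

/-- `L₂(n)`: partitions counted by `L(n)` with an even number of blue parts. -/
def L2 (n : ℕ) : ℕ := {p ∈ LSet n | Even p.1.card}.ncard

/-- `L₃(n)`: partitions counted by `L(n)` with an odd number of blue parts. -/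
def L3 (n : ℕ) : ℕ := {p ∈ LSet n | Odd p.1.card}.ncard

namespace G01

def mR (m : Multiset ℕ) : ℕ := (m.toFinset.filter (fun x => 2 ≤ m.count x)).sup id
def mB (m : Multiset ℕ) : ℕ := (m.toFinset.filter (fun x => Even x)).sup id

def inv (m : Multiset ℕ) : Multiset ℕ :=
  if mB m < 2 * mR m then 2 * mR m ::ₘ (m.erase (mR m)).erase (mR m)
  else (mB m / 2) ::ₘ (mB m / 2) ::ₘ m.erase (mB m)

def P (s : Multiset ℕ) (r : ℕ) : Prop :=
  0 < r ∧ (∀ x ∈ s, Even x → x < 2 * r) ∧ ∀ x, 2 ≤ s.count x → x ≤ r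

lemma le_mR {m : Multiset ℕ} {x : ℕ} (h : 2 ≤ m.count x) : x ≤ mR m := by
  have : x ∈ m := Multiset.count_pos.1 (by omega)
  exact Finset.le_sup (f := id) (by simp [this, h])

lemma le_mB {m : Multiset ℕ} {x : ℕ} (h : x ∈ m) (he : Even x) : x ≤ mB m :=
  Finset.le_sup (f := id) (by simp [h, he])

lemma mR_le {m : Multiset ℕ} {k : ℕ} (h : ∀ x, 2 ≤ m.count x → x ≤ k) : mR m ≤ k :=
  Finset.sup_le fun x hx => h x (by simpa using (Finset.mem_filter.1 hx).2)

lemma mB_le {m : Multiset ℕ} {k : ℕ} (h : ∀ x ∈ m, Even x → x ≤ k) : mB m ≤ k :=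
  Finset.sup_le fun x hx => h x (by simpa using (Finset.mem_filter.1 hx).1)
    (Finset.mem_filter.1 hx).2

lemma mR_spec {m : Multiset ℕ} (h : 0 < mR m) : 2 ≤ m.count (mR m) := by
  have hne : (m.toFinset.filter (fun x => 2 ≤ m.count x)).Nonempty := by
    by_contra hc
    rw [Finset.not_nonempty_iff_eq_empty] at hc
    simp [mR, hc] at h
  obtain ⟨x, hx, he⟩ := Finset.exists_mem_eq_sup _ hne id
  have := (Finset.mem_filter.1 hx).2
  unfold mR; rw [he]; exact this

lemma mB_spec {m : Multiset ℕ} (h : 0 < mB m) : mB m ∈ m ∧ Even (mB m) := by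
  have hne : (m.toFinset.filter (fun x => Even x)).Nonempty := by
    by_contra hc
    rw [Finset.not_nonempty_iff_eq_empty] at hc
    simp [mB, hc] at h
  obtain ⟨x, hx, he⟩ := Finset.exists_mem_eq_sup _ hne id
  have := Finset.mem_filter.1 hx
  unfold mB; rw [he]; simpa using this

lemma inv_merge {s : Multiset ℕ} {r : ℕ} (h : P s r) : inv (r ::ₘ r ::ₘ s) = 2 * r ::ₘ s := by
  obtain ⟨h0, h1, h2⟩ := h
  have hR : mR (r ::ₘ r ::ₘ s) = r := by
    apply le_antisymm
    · apply mR_le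
      intro x hx
      by_cases hxr : x = r
      · omega
      · simp [hxr] at hx
        exact h2 x hx
    · apply le_mR; simp
  have hB : mB (r ::ₘ r ::ₘ s) < 2 * r := by
    have : mB (r ::ₘ r ::ₘ s) ≤ 2 * r - 1 := by
      apply mB_le
      intro x hx he
      simp at hx
      rcases hx with rfl | hx
      · omega
      · have := h1 x hx he; omega
    omega
  unfold inv
  rw [hR, if_pos hB]; simp

lemma inv_split {s : Multiset ℕ} {r : ℕ} (h : P s r) : inv (2 * r ::ₘ s) = r ::ₘ r ::ₘ s := by
  obtain ⟨h0, h1, h2⟩ := h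
  have hR : mR (2 * r ::ₘ s) ≤ r := by
    apply mR_le
    intro x hx
    by_cases hxr : x = 2 * r
    · have : x ∈ s := Multiset.count_pos.1 (by
        simp [hxr] at hx ⊢; omega)
      have := h1 x this (by simp [hxr]); omega
    · simp [hxr] at hx
      exact h2 x hx
  have hB : mB (2 * r ::ₘ s) = 2 * r := by
    apply le_antisymm
    · apply mB_le
      intro x hx he
      simp at hx
      rcases hx with rfl | hx
      · omega
      · have := h1 x hx he; omega
    · apply le_mB <;> simp
  unfold inv
  rw [hB, if_neg (by omega)]; simp

def Fx (m : Multiset ℕ) : Prop := (∀ x ∈ m, Odd x) ∧ m.Nodup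

lemma cases_m (m : Multiset ℕ) (hp : ∀ x ∈ m, 0 < x) (hf : ¬ Fx m) :
    ∃ s r, P s r ∧ (m = r ::ₘ r ::ₘ s ∨ m = 2 * r ::ₘ s) := by
  by_cases h : mB m < 2 * mR m
  · have hc := mR_spec (m := m) (by omega)
    obtain ⟨s, hs⟩ := Multiset.exists_cons_of_mem (a := mR m) (s := m)
      (Multiset.count_pos.1 (by omega))
    have hc1 : 1 ≤ s.count (mR m) := by
      rw [hs, ← hs] at hc
      have := congrArg (Multiset.count (mR m)) hs
      rw [Multiset.count_cons_self] at this; omega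
    obtain ⟨t, ht⟩ := Multiset.exists_cons_of_mem (a := mR m) (s := s)
      (Multiset.count_pos.1 (by omega))
    have hm : m = mR m ::ₘ mR m ::ₘ t := by rw [← ht]; exact hs
    refine ⟨t, mR m, ⟨by omega, ?_, ?_⟩, Or.inl hm⟩
    · intro x hx he
      have : x ∈ m := by rw [hm]; simp [hx]
      have := le_mB this he; omega
    · intro x hx
      apply le_mR
      refine hx.trans (Multiset.count_le_of_le _ ?_)
      conv_rhs => rw [hm]
      exact (Multiset.le_cons_self _ _).trans (Multiset.le_cons_self _ _)
  · have hB : 0 < mB m := by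
      by_contra h0
      apply hf
      constructor
      · intro x hx
        by_contra ho
        have := le_mB hx (Nat.not_odd_iff_even.1 ho)
        have := hp x hx; omega
      · rw [Multiset.nodup_iff_count_le_one]
        intro x
        by_contra hx
        have h3 := le_mR (m := m) (x := x) (by omega)
        have := hp x (Multiset.count_pos.1 (by omega)); omega
    obtain ⟨hm, he⟩ := mB_spec hB
    obtain ⟨r, hr⟩ := he
    obtain ⟨s, hs⟩ := Multiset.exists_cons_of_mem hm
    have hle : s ≤ m := by conv_rhs => rw [hs]
                           exact Multiset.le_cons_self _ _
    refine ⟨s, r, ⟨by omega, ?_, ?_⟩, Or.inr (by rw [two_mul, ← hr]; exact hs)⟩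
    · intro x hx he
      have h1 := le_mB (Multiset.mem_of_le hle hx) he
      rcases Nat.lt_or_ge x (2 * r) with h2 | h2
      · exact h2
      · exfalso
        have hx2 : x = mB m := by omega
        have : 2 ≤ m.count (mB m) := by
          rw [congrArg (Multiset.count (mB m)) hs, Multiset.count_cons_self]
          have := Multiset.count_pos.2 (hx2 ▸ hx); omega
        have := le_mR this; omega
    · intro x hx
      have := le_mR (hx.trans (Multiset.count_le_of_le x hle)); omega

lemma evenParts_cons (a : ℕ) (s : Multiset ℕ) :
    evenParts (a ::ₘ s) = evenParts s + if Even a then 1 else 0 := by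
  unfold evenParts
  by_cases h : Even a <;> simp [h]

lemma inv_props (m : Multiset ℕ) (hp : ∀ x ∈ m, 0 < x) (hf : ¬ Fx m) :
    (∀ x ∈ inv m, 0 < x) ∧ ¬ Fx (inv m) ∧ (inv m).sum = m.sum ∧ inv (inv m) = m ∧
    (-1 : ℤ) ^ evenParts m + (-1) ^ evenParts (inv m) = 0 := by
  obtain ⟨s, r, hP, h | h⟩ := cases_m m hp hf
  · have h0 := hP.1
    subst h
    rw [inv_merge hP, inv_split hP]
    refine ⟨?_, ?_, ?_, rfl, ?_⟩
    · intro x hx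
      simp at hx
      rcases hx with rfl | hx
      · omega
      · exact hp x (by simp [hx])
    · intro hF
      exact Nat.not_odd_iff_even.2 (even_two_mul r) (hF.1 (2 * r) (by simp))
    · simp; ring
    · simp only [evenParts_cons]
      by_cases he : Even r <;> simp [he, pow_add]
  · have h0 := hP.1
    subst h
    rw [inv_split hP, inv_merge hP]
    refine ⟨?_, ?_, ?_, rfl, ?_⟩
    · intro x hx
      simp at hx
      rcases hx with rfl | hx
      · omega
      · exact hp x (by simp [hx])
    · intro hF
      have := hF.2
      simp at this
    · simp; ring
    · simp only [evenParts_cons]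
      by_cases he : Even r <;> simp [he, pow_add]

lemma finite_GSet (n : ℕ) : (GSet n).Finite := by
  have hA : (⋃ k ∈ Set.Iic n, Set.range (fun p : Nat.Partition k => p.parts)).Finite :=
    (Set.finite_Iic n).biUnion fun k _ => Set.finite_range _
  refine (hA.prod hA).subset ?_
  rintro ⟨a, b⟩ ⟨h1, h2, h3, -⟩
  simp only at h1 h2 h3
  refine ⟨?_, ?_⟩
  · simp only [Set.mem_iUnion]
    exact ⟨a.sum, by simp; omega, ⟨a, fun {i} hi => h1 i hi, rfl⟩, rfl⟩
  · simp only [Set.mem_iUnion]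
    exact ⟨b.sum, by simp; omega, ⟨b, fun {i} hi => h2 i hi, rfl⟩, rfl⟩

lemma R_eq_H (n : ℕ) : ({p ∈ GSet n | Fx p.1}).ncard = (HSet n).ncard := by
  refine Set.ncard_congr (fun p _ => p.1 + p.2) ?_ ?_ ?_
  · rintro ⟨a, b⟩ ⟨⟨h1, h2, h3, h4⟩, h5, h6⟩
    simp only at h1 h2 h3 h4 h5 h6
    refine ⟨?_, by simpa using h3, ?_⟩
    · intro x hx
      rcases Multiset.mem_add.1 hx with h | h
      · exact h1 x h
      · exact h2 x h
    · rw [Multiset.filter_add, Multiset.filter_eq_self.2 h5, Multiset.filter_eq_nil.2]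
      · simpa using h6
      · intro x hx; simpa using h4 x hx
  · rintro ⟨a, b⟩ ⟨a', b'⟩ ⟨⟨-, -, -, h4⟩, h5, -⟩ ⟨⟨-, -, -, h4'⟩, h5', -⟩ h
    simp only at h4 h5 h4' h5' h
    have key : ∀ a b : Multiset ℕ, (∀ x ∈ b, Even x) → (∀ x ∈ a, Odd x) →
        (a + b).filter (fun x => Odd x) = a := by
      intro a b hb ha
      rw [Multiset.filter_add, Multiset.filter_eq_self.2 ha, Multiset.filter_eq_nil.2]
      · simp
      · intro x hx; simpa using hb x hx
    have ha : a = a' := by rw [← key a b h4 h5, h, key a' b' h4' h5']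
    subst ha
    simpa using h
  · rintro m ⟨h1, h2, h3⟩
    have hs : m.filter (fun x => Odd x) + m.filter (fun x => ¬ Odd x) = m :=
      Multiset.filter_add_not _ _
    refine ⟨(m.filter (fun x => Odd x), m.filter (fun x => ¬ Odd x)), ⟨⟨?_, ?_, ?_, ?_⟩, ?_, h3⟩, hs⟩
    · intro x hx; exact h1 x (Multiset.mem_filter.1 hx).1
    · intro x hx; exact h1 x (Multiset.mem_filter.1 hx).1
    · rw [← Multiset.sum_add, hs, h2]
    · intro x hx; exact Nat.not_odd_iff_even.1 (Multiset.mem_filter.1 hx).2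
    · intro x hx; exact (Multiset.mem_filter.1 hx).2

end G01

open G01


/-- `G₀(n) - G₁(n) = H(n)`. -/
theorem G0_sub_G1 (n : ℕ) : (G0 n : ℤ) - (G1 n : ℤ) = (Hcount n : ℤ) := by
  classical
  unfold G0 G1 Hcount
  rw [← R_eq_H]
  obtain ⟨T, hT⟩ := (finite_GSet n).exists_finset_coe
  have hmem : ∀ p, p ∈ T ↔ p ∈ GSet n := fun p => by rw [← hT]; simp
  have hc : ∀ (Q : Multiset ℕ × Multiset ℕ → Prop) [DecidablePred Q],
      ({p ∈ GSet n | Q p}).ncard = (T.filter Q).card := by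
    intro Q _
    rw [← Set.ncard_coe_finset]
    congr 1; ext p; simp [hmem]
  rw [hc (fun p => Even (evenParts p.1)), hc (fun p => Odd (evenParts p.1)), hc (fun p => Fx p.1)]
  have e1 : ∑ p ∈ T, (-1 : ℤ) ^ evenParts p.1 =
      ((T.filter fun p => Even (evenParts p.1)).card : ℤ) -
      ((T.filter fun p => Odd (evenParts p.1)).card : ℤ) := by
    rw [Finset.card_filter, Finset.card_filter]
    push_cast
    rw [← Finset.sum_sub_distrib]
    refine Finset.sum_congr rfl fun p _ => ?_
    rcases Nat.even_or_odd (evenParts p.1) with h | h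
    · simp [h, h.neg_one_pow, Nat.not_odd_iff_even.2 h]
    · simp [h, h.neg_one_pow, Nat.not_even_iff_odd.2 h]
  have e2 : ∑ p ∈ T with Fx p.1, (-1 : ℤ) ^ evenParts p.1 =
      ((T.filter fun p => Fx p.1).card : ℤ) := by
    rw [Finset.card_eq_sum_ones]
    push_cast
    refine Finset.sum_congr rfl fun p hp => ?_
    have h := (Finset.mem_filter.1 hp).2.1
    have : evenParts p.1 = 0 := by
      unfold evenParts
      rw [Multiset.card_eq_zero, Multiset.filter_eq_nil]
      intro x hx; simpa using h x hx
    simp [this]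
  have e3 : ∑ p ∈ T with ¬ Fx p.1, (-1 : ℤ) ^ evenParts p.1 = 0 := by
    refine Finset.sum_involution (fun p _ => (inv p.1, p.2)) ?_ ?_ ?_ ?_
    · intro p hp
      obtain ⟨h, hf⟩ := Finset.mem_filter.1 hp
      exact (inv_props p.1 ((hmem p).1 h).1 hf).2.2.2.2
    · intro p hp hne heq
      obtain ⟨h, hf⟩ := Finset.mem_filter.1 hp
      have h1 := (inv_props p.1 ((hmem p).1 h).1 hf).2.2.2.2
      have h2 : inv p.1 = p.1 := congrArg Prod.fst heq
      rw [h2] at h1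
      omega
    · intro p hp
      obtain ⟨h, hf⟩ := Finset.mem_filter.1 hp
      obtain ⟨g1, g2, g3, g4⟩ := (hmem p).1 h
      obtain ⟨a, b, c, -, -⟩ := inv_props p.1 g1 hf
      refine Finset.mem_filter.2 ⟨(hmem _).2 ⟨a, g2, ?_, g4⟩, b⟩
      simp only [c]; exact g3
    · intro p hp
      obtain ⟨h, hf⟩ := Finset.mem_filter.1 hp
      exact Prod.ext (inv_props p.1 ((hmem p).1 h).1 hf).2.2.2.1 rfl
  rw [← e1, ← e2, ← Finset.sum_filter_add_sum_filter_not T (fun p => Fx p.1), e3, add_zero]
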